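/- arXiv:2108.02300 — 2 statements merged into one kernel-verified Lean document; each statement's English description precedes it below -/
import Mathlib

section
/- (Descent inequality, inequality (5)/(7) in the proof of Theorem 1.) Let φ, ψ : ℝᵐ → ℝ ∪ {+∞} be proper convex functions with moduli of strong convexity ρ(φ) ≥ ρ₁ ≥ 0 and ρ(ψ) ≥ ρ₂ ≥ 0. Let w ∈ dom φ ∩ dom ψ, let ν ∈ ∂ψ(w), let t ∈ ℝᵐ, and let w⁺ be a minimizer over ℝᵐ of the function u ↦ φ(u) − ⟨t, u⟩, with ψ(w⁺) < +∞. Then φ(w⁺) − ψ(w⁺) ≤ φ(w) − ψ(w) − ((ρ₁ + ρ₂)/2) ‖w⁺ − w‖² + ⟨t − ν, w⁺ − w⟩. -/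
open RealInnerProductSpace

noncomputable section

/-- Subdifferential at `x` of the extended-real-valued convex function equal to `θ` on its
domain `D` and to `+∞` outside of `D` (so that `∂θ(x) = ∅` whenever `x ∉ D`). -/
def subdiffOn {E : Type*} [NormedAddCommGroup E] [InnerProductSpace ℝ E]
    (D : Set E) (θ : E → ℝ) (x : E) : Set E :=
  {y | x ∈ D ∧ ∀ u ∈ D, θ x + ⟪y, u - x⟫ ≤ θ u}

/-- Modulus of strong convexity of the proper convex function with domain `D` given by `θ`
on `D` and `+∞` outside: `ρ(θ) = sup {μ ≥ 0 : θ - (μ/2)‖·‖² is convex}`. -/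
def scModulus {E : Type*} [NormedAddCommGroup E] [InnerProductSpace ℝ E]
    (D : Set E) (θ : E → ℝ) : ℝ :=
  sSup {μ : ℝ | 0 ≤ μ ∧ ConvexOn ℝ D fun x => θ x - μ / 2 * ‖x‖ ^ 2}

theorem le_of_mem_subdiffOn_of_convexOn_sub
    {E : Type*} [NormedAddCommGroup E] [InnerProductSpace ℝ E]
    {D : Set E} {θ : E → ℝ} {x y u : E} {μ : ℝ} (hy : y ∈ subdiffOn D θ x) (hu : u ∈ D)
    (hμ : ConvexOn ℝ D fun z => θ z - μ / 2 * ‖z‖ ^ 2) :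
    θ x + ⟪y, u - x⟫ + μ / 2 * ‖u - x‖ ^ 2 ≤ θ u := by
  obtain ⟨hx, hsub⟩ := hy
  have key : ∀ s : ℝ, 0 < s → s < 1 →
      (1 - s) * (μ / 2 * ‖u - x‖ ^ 2) ≤ θ u - θ x - ⟪y, u - x⟫ := by
    intro s hs hs1
    have hconv := hμ.2 hx hu (sub_nonneg.2 hs1.le) hs.le (by ring)
    have hmem := hμ.1 hx hu (sub_nonneg.2 hs1.le) hs.le (by ring)
    have hlow := hsub _ hmem
    have hdiff : (1 - s) • x + s • u - x = s • (u - x) := by module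
    have hnorm : ‖(1 - s) • x + s • u‖ ^ 2
        = (1 - s) * ‖x‖ ^ 2 + s * ‖u‖ ^ 2 - s * (1 - s) * ‖u - x‖ ^ 2 := by
      rw [norm_add_sq_real, norm_sub_sq_real, norm_smul, norm_smul, real_inner_smul_left,
        real_inner_smul_right, real_inner_comm, mul_pow, mul_pow, Real.norm_eq_abs,
        Real.norm_eq_abs, sq_abs, sq_abs]
      ring
    rw [hdiff, real_inner_smul_right] at hlow
    simp only [smul_eq_mul, hnorm] at hconv
    refine le_of_mul_le_mul_left ?_ hs
    linarith
  have hC := hsub u hu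
  by_contra! hlt
  have hA : 0 < μ / 2 * ‖u - x‖ ^ 2 := by linarith
  generalize μ / 2 * ‖u - x‖ ^ 2 = A at *
  have h := key ((A - (θ u - θ x - ⟪y, u - x⟫)) / (2 * A))
    (by apply div_pos <;> linarith) (by rw [div_lt_one] <;> linarith)
  have h' : (1 - (A - (θ u - θ x - ⟪y, u - x⟫)) / (2 * A)) * A
      = (A + (θ u - θ x - ⟪y, u - x⟫)) / 2 := by
    field_simp
    ring
  linarith

theorem le_of_mem_subdiffOn_of_le_scModulus
    {E : Type*} [NormedAddCommGroup E] [InnerProductSpace ℝ E]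
    {D : Set E} {θ : E → ℝ} {x y u : E} {ρ : ℝ} (hy : y ∈ subdiffOn D θ x) (hu : u ∈ D)
    (hρ : ρ ≤ scModulus D θ) :
    θ x + ⟪y, u - x⟫ + ρ / 2 * ‖u - x‖ ^ 2 ≤ θ u := by
  have hC := hy.2 u hu
  rcases (sq_nonneg ‖u - x‖).eq_or_lt with h0 | hpos
  · rw [← h0]
    linarith
  · have hle : scModulus D θ ≤ 2 * (θ u - θ x - ⟪y, u - x⟫) / ‖u - x‖ ^ 2 := by
      refine Real.sSup_le (fun μ hμ => ?_) (div_nonneg (by linarith) hpos.le)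
      rw [le_div_iff₀ hpos]
      linarith [le_of_mem_subdiffOn_of_convexOn_sub hy hu hμ.2]
    have h := (le_div_iff₀ hpos).1 (hρ.trans hle)
    linarith

/-- **Descent inequality** (inequality (5)/(7) in the proof of Theorem 1). A proper convex
function `ℝᵐ → ℝ ∪ {+∞}` is encoded by its (nonempty convex) domain `D` together with its
real values `θ` on `D`. If `ρ(φ) ≥ ρ₁ ≥ 0`, `ρ(ψ) ≥ ρ₂ ≥ 0`, `w ∈ dom φ ∩ dom ψ`,
`ν ∈ ∂ψ(w)`, and `w⁺` minimizes `u ↦ φ(u) - ⟨t, u⟩` over `ℝᵐ` with `ψ(w⁺) < +∞`, then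
`φ(w⁺) - ψ(w⁺) ≤ φ(w) - ψ(w) - ((ρ₁+ρ₂)/2)‖w⁺ - w‖² + ⟨t - ν, w⁺ - w⟩`. -/
theorem descent_inequality
    {E : Type*} [NormedAddCommGroup E] [InnerProductSpace ℝ E]
    -- φ with domain Dφ, ψ with domain Dψ
    (Dφ Dψ : Set E) (hDφ : Convex ℝ Dφ) (hDψ : Convex ℝ Dψ)
    (hDφne : Dφ.Nonempty) (hDψne : Dψ.Nonempty)
    (φ ψ : E → ℝ) (hφconv : ConvexOn ℝ Dφ φ) (hψconv : ConvexOn ℝ Dψ ψ)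
    -- moduli of strong convexity: ρ(φ) ≥ ρ₁ ≥ 0 and ρ(ψ) ≥ ρ₂ ≥ 0
    (ρ₁ ρ₂ : ℝ) (hρ₁ : 0 ≤ ρ₁) (hρ₂ : 0 ≤ ρ₂)
    (hφsc : ρ₁ ≤ scModulus Dφ φ) (hψsc : ρ₂ ≤ scModulus Dψ ψ)
    -- w ∈ dom φ ∩ dom ψ, ν ∈ ∂ψ(w), t ∈ ℝᵐ
    (w : E) (hw : w ∈ Dφ ∩ Dψ)
    (ν : E) (hν : ν ∈ subdiffOn Dψ ψ w)
    (t : E)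
    -- w⁺ minimizes u ↦ φ(u) - ⟨t, u⟩ over ℝᵐ (i.e. over dom φ), and ψ(w⁺) < +∞
    (wp : E) (hwp : wp ∈ Dφ)
    (hmin : ∀ u ∈ Dφ, φ wp - ⟪t, wp⟫ ≤ φ u - ⟪t, u⟫)
    (hwpψ : wp ∈ Dψ) :
    φ wp - ψ wp ≤ φ w - ψ w - (ρ₁ + ρ₂) / 2 * ‖wp - w‖ ^ 2 + ⟪t - ν, wp - w⟫ := by
  have ht : t ∈ subdiffOn Dφ φ wp := by
    refine ⟨hwp, fun u hu => ?_⟩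
    rw [inner_sub_right]
    linarith [hmin u hu]
  have hφ := le_of_mem_subdiffOn_of_le_scModulus ht hw.1 hφsc
  have hψ := le_of_mem_subdiffOn_of_le_scModulus hν hwpψ hψsc
  rw [norm_sub_rev, inner_sub_right] at hφ
  rw [inner_sub_left, inner_sub_right t]
  linarith
end
end

section
/- (Rademacher complexity bound, Case 3: discrete support.) Suppose Ξ ⊆ ℝⁿ is a finite set with |Ξ| = N_Ξ and there exists M > 0 such that |g(w,z)| ≤ M for all w ∈ S, z ∈ Ξ. Then for every k ≥ 1, R_k(g, Ξ) ≤ M √(N_Ξ / k). -/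
noncomputable section

/-- Rademacher average `R_l(g, Ξ)` of the family `{g(·,z) : z ∈ Ξ}` over the set `S`:
`R_l(g,Ξ) = sup_{z₁,…,z_l ∈ Ξ} 𝔼_σ sup_{w ∈ S} |(1/l) Σᵢ σᵢ g(w,zᵢ)|`, where the
expectation over the i.i.d. signs `σᵢ ∈ {±1}` is written as a uniform average over all
`2^l` sign patterns. -/
def rademacherAvg {E F : Type*} (S : Set E) (Ξ : Set F) (g : E → F → ℝ) (l : ℕ) : ℝ :=
  ⨆ z : Fin l → Ξ, (2 ^ l : ℝ)⁻¹ * ∑ σ : Fin l → Bool,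
    ⨆ w : S, |(l : ℝ)⁻¹ * ∑ i, (if σ i then (1 : ℝ) else -1) * g ↑w ↑(z i)|

/-- Distinct Rademacher signs are orthogonal, and each has second moment `1`. -/
lemma sum_rademacher_mul {ι : Type*} [Fintype ι] [DecidableEq ι] (i j : ι) :
    ∑ σ : ι → Bool, (if σ i then (1 : ℝ) else -1) * (if σ j then (1 : ℝ) else -1) =
      if i = j then 2 ^ Fintype.card ι else 0 := by
  split_ifs with hij
  · subst hij
    have hsq (b : Bool) : (if b then (1 : ℝ) else -1) * (if b then (1 : ℝ) else -1) = 1 := by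
      cases b <;> simp
    simp [hsq]
  · refine Finset.sum_involution (fun σ _ => Function.update σ i (!σ i)) ?_ ?_ ?_ ?_
    · intro σ _
      rw [Function.update_self, Function.update_of_ne (Ne.symm hij)]
      cases σ i <;> simp <;> split_ifs <;> norm_num
    · intro σ _ _ h
      simpa using congrFun h i
    · simp
    · simp

/-- The second moment of a Rademacher sum, multiplied by the number of sign patterns. -/
lemma sum_sq_rademacher_sum {ι : Type*} [Fintype ι] [DecidableEq ι] (b : ι → ℝ) :
    ∑ σ : ι → Bool, (∑ i, (if σ i then (1 : ℝ) else -1) * b i) ^ 2 =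
      2 ^ Fintype.card ι * ∑ i, b i ^ 2 := by
  calc
    _ = ∑ i, ∑ j, b i * b j *
        ∑ σ : ι → Bool, (if σ i then (1 : ℝ) else -1) * (if σ j then (1 : ℝ) else -1) := by
      simp_rw [sq, Finset.sum_mul_sum, Finset.mul_sum]
      rw [Finset.sum_comm]
      refine Finset.sum_congr rfl fun i _ => ?_
      rw [Finset.sum_comm]
      exact Finset.sum_congr rfl fun j _ => Finset.sum_congr rfl fun σ _ => by ring
    _ = _ := by
      simp_rw [sum_rademacher_mul]
      simp only [mul_ite, mul_zero, Finset.sum_ite_eq, Finset.mem_univ, if_true, Finset.mul_sum]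
      exact Finset.sum_congr rfl fun i _ => by ring

/-- Khintchine-type bound for the total absolute value of the Rademacher sums over the fibres
of `z`. -/
lemma sum_abs_fiber_rademacher_le {ι α : Type*} [Fintype ι] [DecidableEq ι] [Fintype α]
    [DecidableEq α] (z : ι → α) :
    ∑ σ : ι → Bool, ∑ a, |∑ i, (if σ i then (1 : ℝ) else -1) * (if z i = a then 1 else 0)| ≤
      2 ^ Fintype.card ι * Real.sqrt (Fintype.card α * Fintype.card ι) := by
  set c : (ι → Bool) × α → ℝ := fun p =>
    ∑ i, (if p.1 i then (1 : ℝ) else -1) * (if z i = p.2 then 1 else 0) with hc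
  have hsq : ∑ p, c p ^ 2 = 2 ^ Fintype.card ι * Fintype.card ι := by
    rw [Fintype.sum_prod_type_right]
    rw [Finset.sum_congr rfl fun a _ =>
      sum_sq_rademacher_sum fun i => if z i = a then (1 : ℝ) else 0]
    rw [← Finset.mul_sum, Finset.sum_comm]
    simp
  have hcs := sq_sum_le_card_mul_sum_sq (s := Finset.univ) (f := fun p => |c p|)
  simp only [sq_abs, hsq] at hcs
  rw [← Fintype.sum_prod_type (fun p => |c p|)]
  refine abs_le_of_sq_le_sq' ?_ (by positivity) |>.2
  rw [mul_pow, Real.sq_sqrt (by positivity)]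
  refine hcs.trans (le_of_eq ?_)
  simp
  ring

/-- **Rademacher complexity bound, Case 3 (discrete support).** If `Ξ` is finite with
`|Ξ| = N_Ξ` and `|g(w,z)| ≤ M` on `S × Ξ`, then `R_k(g,Ξ) ≤ M √(N_Ξ / k)` for all
`k ≥ 1`. -/
theorem rademacher_bound_discrete
    {E F : Type*} [NormedAddCommGroup E] [InnerProductSpace ℝ E]
    (S : Set E) (hSne : S.Nonempty) (hScomp : IsCompact S) (hSconv : Convex ℝ S)
    (Ξ : Set F) (hΞfin : Ξ.Finite) (NΞ : ℕ) (hcard : Ξ.ncard = NΞ)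
    (g : E → F → ℝ) (hgcont : ∀ z ∈ Ξ, ContinuousOn (fun w => g w z) S)
    (M : ℝ) (hM : 0 < M) (hbd : ∀ w ∈ S, ∀ z ∈ Ξ, |g w z| ≤ M) :
    ∀ k : ℕ, 1 ≤ k → rademacherAvg S Ξ g k ≤ M * Real.sqrt (NΞ / k) := by
  intro k hk
  have := hΞfin.fintype
  classical
  have hcard' : Fintype.card Ξ = NΞ := by
    rw [← hcard, Set.ncard_eq_toFinset_card', Set.toFinset_card]
  have hk0 : (0 : ℝ) < k := by exact_mod_cast hk
  refine Real.iSup_le (fun z => ?_) (by positivity)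
  have hsup (σ : Fin k → Bool) :
      ⨆ w : S, |(k : ℝ)⁻¹ * ∑ i, (if σ i then (1 : ℝ) else -1) * g ↑w ↑(z i)| ≤
        (k : ℝ)⁻¹ * M * ∑ a : Ξ,
          |∑ i, (if σ i then (1 : ℝ) else -1) * (if z i = a then 1 else 0)| := by
    refine Real.iSup_le (fun w => ?_) (by positivity)
    have hfib : ∑ i, (if σ i then (1 : ℝ) else -1) * g ↑w ↑(z i) =
        ∑ a : Ξ, g w a * ∑ i, (if σ i then (1 : ℝ) else -1) * (if z i = a then 1 else 0) := by
      simp_rw [Finset.mul_sum]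
      rw [Finset.sum_comm]
      refine Finset.sum_congr rfl fun i _ => ?_
      simp [mul_comm]
    rw [abs_mul, abs_of_pos (inv_pos.2 hk0), hfib, mul_assoc, Finset.mul_sum _ _ M]
    gcongr
    refine (Finset.abs_sum_le_sum_abs _ _).trans (Finset.sum_le_sum fun a _ => ?_)
    rw [abs_mul]
    gcongr
    exact hbd w w.2 a a.2
  have hfib := sum_abs_fiber_rademacher_le z
  rw [hcard', Fintype.card_fin] at hfib
  calc
    _ ≤ (2 ^ k : ℝ)⁻¹ * ((k : ℝ)⁻¹ * M * (2 ^ k * Real.sqrt (NΞ * k))) := by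
      gcongr
      refine (Finset.sum_le_sum fun σ _ => hsup σ).trans ?_
      rw [← Finset.mul_sum]
      gcongr
    _ = M * Real.sqrt (NΞ / k) := by
      have hsqrt : Real.sqrt (NΞ * k) = k * Real.sqrt (NΞ / k) := by
        rw [show (NΞ * k : ℝ) = k ^ 2 * (NΞ / k) by field_simp, Real.sqrt_mul (by positivity),
          Real.sqrt_sq hk0.le]
      rw [hsqrt]
      field_simp
end
end
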